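/- Let χ = 0, let K denote the one-dimensional trivial W-module, and let S be the (p-1)-dimensional simple restricted W-module. Then Ext(K, S), taken in the category of restricted W-modules (U_0(W)-modules), is isomorphic to K^2, i.e. the space of Baer-equivalence classes of short exact sequences 0 → S → M → K → 0 of restricted W-modules is two-dimensional over K. -/

import Mathlib

/-!
Common setup: the Witt algebra `W` over `K` (char `p > 3`) has basis
`e_{-1}, e_0, ..., e_{p-2}` with `[e_i, e_j] = (j-i) e_{i+j}` (and `e_k = 0`
outside the range), and `p`-mapping `e_i^{[p]} = δ_{i0} e_i`.  A module with
`p`-character `χ` over `W` (resp. the subalgebra `W_0 = <e_0, ..., e_{p-2}>`)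
is given by a family of endomorphisms `ρ k` (`k : ℤ`, vanishing outside
`[lo, p-2]` where `lo = -1` for `W` and `lo = 0` for `W_0`) satisfying the
bracket relations and `(ρ i)^p - δ_{i0} ρ i = χ(e_i)^p • 1`.

The Baer Ext space `Ext(N, M)` of two such modules, in the category of
modules with `p`-character `χ`, is realized concretely: an extension
`0 → M → E → N → 0` admits a linear splitting `E ≃ M ⊕ N`, under which the
action of `e_k` is `(m, n) ↦ (ρM k m + c k n, ρN k n)` for a "cocycle"
`c : ℤ → (N →ₗ M)`; the conditions for `E` to be a module with `p`-character
`χ` are the cocycle conditions below, Baer equivalence corresponds to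
differing by a coboundary, and the Baer sum / scalar action correspond to the
linear structure on cocycles.  So `Ext(N, M) ≅ cocycles / coboundaries`.
-/

set_option maxHeartbeats 1000000
set_option synthInstance.maxHeartbeats 1000000

noncomputable section

/-- The coefficient `(-1)^j · (i!/(i-j)!) · ((j+1)λ - i + j)` of the action
`e_j · v_i = (coefficient) · v_{i-j}` on the reduced Verma module; it vanishes
for `j > i` since then `Nat.descFactorial i j = 0`. -/
def wCoef (K : Type) [Field K] (lam : K) (j i : ℕ) : K :=
  (-1 : K) ^ j * (Nat.descFactorial i j : K) * (((j : K) + 1) * lam - (i : K) + (j : K))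

/-- Matrices (in the basis `v_0, ..., v_{p-1}`) of the generators `e_j`
(`j : ℤ`) acting on the reduced Verma module `V_χ(λ)`; here `c = χ(e_{-1})^p`.
`e_{-1} v_i = v_{i+1}` for `i < p-1`, `e_{-1} v_{p-1} = c v_0`, and for
`0 ≤ j ≤ p-2`, `e_j v_i = (-1)^j (i!/(i-j)!) ((j+1)λ - i + j) v_{i-j}`. -/
def vermaMat (K : Type) [Field K] (p : ℕ) (c lam : K) : ℤ → Matrix (Fin p) (Fin p) K :=
  fun j =>
    if j = -1 then
      Matrix.of fun k l =>
        if (k : ℕ) = (l : ℕ) + 1 then 1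
        else if (k : ℕ) = 0 ∧ (l : ℕ) = p - 1 then c else 0
    else if 0 ≤ j ∧ j ≤ (p : ℤ) - 2 then
      Matrix.of fun k l =>
        if (l : ℕ) = (k : ℕ) + j.toNat then wCoef K lam j.toNat (l : ℕ) else 0
    else 0

/-- The action of the basis elements `e_j` (`j : ℤ`) on the reduced Verma
module `V_χ(λ)`, with `c = χ(e_{-1})^p`. -/
def vermaRho (K : Type) [Field K] (p : ℕ) (c lam : K) : ℤ → Module.End K (Fin p → K) :=
  fun j => Matrix.toLin' (vermaMat K p c lam j)

/-- The one-dimensional `W_0`-module `K_λ`: `e_0` acts by `λ`, all other `e_j` act by `0`. -/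
def oneDimRho (K : Type) [Field K] (lam : K) : ℤ → Module.End K K :=
  fun j => if j = 0 then lam • (1 : Module.End K K) else 0

/-- The one-dimensional trivial module: every basis element acts by `0`. -/
def trivRho (K : Type) [Field K] : ℤ → Module.End K K := fun _ => 0

/-- The coefficient `(-1)^(j+1) · ((i+1)!/(i-j)!)` of the action
`e_j · u_i = (coefficient) · u_{i-j}` on the `(p-1)`-dimensional simple module `S`. -/
def sCoef (K : Type) [Field K] (j i : ℕ) : K :=
  (-1 : K) ^ (j + 1) * (Nat.descFactorial (i + 1) (j + 1) : K)

/-- Matrices (in the basis `u_0, ..., u_{p-2}`) of the generators `e_j` acting on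
the `(p-1)`-dimensional simple restricted module `S = V_0(p-1)/Soc(V_0(p-1))`. -/
def sMat (K : Type) [Field K] (p : ℕ) : ℤ → Matrix (Fin (p - 1)) (Fin (p - 1)) K :=
  fun j =>
    if j = -1 then
      Matrix.of fun k l => if (k : ℕ) = (l : ℕ) + 1 then 1 else 0
    else if 0 ≤ j ∧ j ≤ (p : ℤ) - 2 then
      Matrix.of fun k l =>
        if (l : ℕ) = (k : ℕ) + j.toNat then sCoef K j.toNat (l : ℕ) else 0
    else 0

/-- The action of the basis elements `e_j` on the simple module `S`. -/
def sRho (K : Type) [Field K] (p : ℕ) : ℤ → Module.End K (Fin (p - 1) → K) :=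
  fun j => Matrix.toLin' (sMat K p j)

section ExtSpace

variable (K : Type) [Field K] (M N : Type) [AddCommGroup M] [Module K M]
  [AddCommGroup N] [Module K N]

/-- Constraint: a cocycle vanishes outside the index range `[lo, p-2]`. -/
def suppConstraint (p : ℕ) (lo k : ℤ) : (ℤ → N →ₗ[K] M) →ₗ[K] (N →ₗ[K] M) :=
  if k < lo ∨ (p : ℤ) - 2 < k then LinearMap.proj k else 0

variable {M N}

/-- Constraint on a cocycle coming from the bracket relation
`[e_i, e_j] = (j - i) e_{i+j}`:
`(j-i) c(i+j) = ρM i ∘ c j + c i ∘ ρN j - ρM j ∘ c i - c j ∘ ρN i`. -/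
def bracketConstraint (p : ℕ) (lo : ℤ) (ρM : ℤ → Module.End K M)
    (ρN : ℤ → Module.End K N) (i j : ℤ) :
    (ℤ → N →ₗ[K] M) →ₗ[K] (N →ₗ[K] M) :=
  if lo ≤ i ∧ i ≤ (p : ℤ) - 2 ∧ lo ≤ j ∧ j ≤ (p : ℤ) - 2 then
    ((j - i : ℤ) : K) • LinearMap.proj (i + j)
      - LinearMap.llcomp K N M M (ρM i) ∘ₗ LinearMap.proj j
      - LinearMap.lcomp K M (ρN j) ∘ₗ LinearMap.proj i
      + LinearMap.llcomp K N M M (ρM j) ∘ₗ LinearMap.proj i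
      + LinearMap.lcomp K M (ρN i) ∘ₗ LinearMap.proj j
  else 0

/-- Constraint on a cocycle expressing that the extension has `p`-character `χ`:
on the extension `E = M ⊕ N` the `(N → M)`-component of `(e_i)^p` is
`∑_{k<p} (ρM i)^k ∘ c i ∘ (ρN i)^(p-1-k)`, and this must agree with the
`(N → M)`-component of `e_i^{[p]} + χ(e_i)^p • 1`, which is `δ_{i0} c i`
(the scalar `χ(e_i)^p` contributes nothing off the diagonal, and the diagonal
blocks hold since `M`, `N` have `p`-character `χ`). -/
def pcharConstraint (p : ℕ) (lo : ℤ) (ρM : ℤ → Module.End K M)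
    (ρN : ℤ → Module.End K N) (i : ℤ) :
    (ℤ → N →ₗ[K] M) →ₗ[K] (N →ₗ[K] M) :=
  if lo ≤ i ∧ i ≤ (p : ℤ) - 2 then
    (∑ k ∈ Finset.range p,
        LinearMap.llcomp K N M M ((ρM i) ^ k) ∘ₗ
          LinearMap.lcomp K M ((ρN i) ^ (p - 1 - k)) ∘ₗ LinearMap.proj i)
      - (if i = 0 then (LinearMap.proj 0 : (ℤ → N →ₗ[K] M) →ₗ[K] (N →ₗ[K] M)) else 0)
  else 0

/-- The space of cocycles: families `c : ℤ → (N →ₗ M)` (the values of a linear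
map `W → Hom(N, M)` on the basis, `lo = -1` for `W` and `lo = 0` for `W_0`)
such that `M ⊕ N` with action `e_k (m, n) = (ρM k m + c k n, ρN k n)` is a
module with `p`-character `χ`. -/
def cocycles (p : ℕ) (lo : ℤ) (ρM : ℤ → Module.End K M) (ρN : ℤ → Module.End K N) :
    Submodule K (ℤ → N →ₗ[K] M) :=
  (⨅ k : ℤ, LinearMap.ker (suppConstraint K M N p lo k)) ⊓
    (⨅ i : ℤ, ⨅ j : ℤ, LinearMap.ker (bracketConstraint K p lo ρM ρN i j)) ⊓
    (⨅ i : ℤ, LinearMap.ker (pcharConstraint K p lo ρM ρN i))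

/-- The coboundaries: cocycles of the form `k ↦ ρM k ∘ f - f ∘ ρN k` for a
linear map `f : N → M`; these are exactly the cocycles of split extensions,
and two cocycles give Baer-equivalent extensions iff they differ by a
coboundary. -/
def coboundaries (p : ℕ) (lo : ℤ) (ρM : ℤ → Module.End K M) (ρN : ℤ → Module.End K N) :
    Submodule K (ℤ → N →ₗ[K] M) :=
  LinearMap.range (LinearMap.pi fun k : ℤ =>
    if lo ≤ k ∧ k ≤ (p : ℤ) - 2 then
      LinearMap.llcomp K N M M (ρM k) - LinearMap.lcomp K M (ρN k)
    else 0)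

/-- The Baer Ext space `Ext(N, M)` in the category of modules with
`p`-character `χ` (over `W` if `lo = -1`, over `W_0` if `lo = 0`), realized
as cocycles modulo coboundaries. -/
abbrev extSpace (p : ℕ) (lo : ℤ) (ρM : ℤ → Module.End K M) (ρN : ℤ → Module.End K N) :=
  (cocycles K p lo ρM ρN) ⧸
    (Submodule.comap (cocycles K p lo ρM ρN).subtype (coboundaries K p lo ρM ρN))

end ExtSpace

end

section TrivialCoefficients

variable {K : Type} [Field K] {M : Type} [AddCommGroup M] [Module K M]

/-- A cocycle with values in `Hom(K, M) ≅ M`, `K` trivial, in terms of the vectors `c k 1`. -/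
theorem mem_cocycles_trivRho_iff {p : ℕ} (hp : 0 < p) {lo : ℤ} {ρ : ℤ → Module.End K M}
    {c : ℤ → K →ₗ[K] M} :
    c ∈ cocycles K p lo ρ (trivRho K) ↔
      (∀ k : ℤ, k < lo ∨ (p : ℤ) - 2 < k → c k 1 = 0) ∧
      (∀ i j : ℤ, lo ≤ i → i ≤ (p : ℤ) - 2 → lo ≤ j → j ≤ (p : ℤ) - 2 →
        ((j - i : ℤ) : K) • c (i + j) 1 = ρ i (c j 1) - ρ j (c i 1)) ∧
      (∀ i : ℤ, lo ≤ i → i ≤ (p : ℤ) - 2 →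
        (ρ i ^ (p - 1)) (c i 1) = if i = 0 then c 0 1 else 0) := by
  have hext : ∀ f : K →ₗ[K] M, f = 0 ↔ f 1 = 0 := fun f =>
    ⟨fun h => by simp [h], fun h => LinearMap.ext_ring (by simpa using h)⟩
  simp only [cocycles, Submodule.mem_inf, Submodule.mem_iInf, LinearMap.mem_ker, and_assoc]
  refine and_congr (forall_congr' fun k => ?_) (and_congr (forall_congr' fun i =>
    forall_congr' fun j => ?_) (forall_congr' fun i => ?_))
  · rw [suppConstraint, hext]
    split_ifs with h <;> simp [h]
  · rw [bracketConstraint, hext]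
    split_ifs with h
    · simp only [h, forall_const]
      simp only [trivRho, LinearMap.add_apply, LinearMap.sub_apply, LinearMap.smul_apply,
        LinearMap.comp_apply, LinearMap.proj_apply, LinearMap.llcomp_apply,
        LinearMap.lcomp_apply, LinearMap.zero_apply, map_zero, sub_zero, add_zero]
      rw [sub_add, sub_eq_zero]
    · simp only [LinearMap.zero_apply, true_iff]
      tauto
  · rw [pcharConstraint, hext]
    by_cases h : lo ≤ i ∧ i ≤ (p : ℤ) - 2
    · simp only [h, and_self, if_true, forall_const]
      rw [Finset.sum_eq_single_of_mem (p - 1) (Finset.mem_range.2 (by omega))]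
      · split_ifs with h0 <;> simp [h0, sub_eq_zero]
      · intro k hk hk'
        have : p - 1 - k ≠ 0 := by have := Finset.mem_range.1 hk; omega
        ext
        simp [trivRho, this, LinearMap.lcomp_apply]
    · simp only [if_neg h, LinearMap.zero_apply, true_iff]
      exact fun h1 h2 => (h ⟨h1, h2⟩).elim

theorem mem_coboundaries_trivRho_iff {p : ℕ} {lo : ℤ} {ρ : ℤ → Module.End K M}
    {c : ℤ → K →ₗ[K] M} :
    c ∈ coboundaries K p lo ρ (trivRho K) ↔
      ∃ m : M, ∀ k : ℤ, c k 1 = if lo ≤ k ∧ k ≤ (p : ℤ) - 2 then ρ k m else 0 := by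
  rw [coboundaries, LinearMap.mem_range]
  constructor
  · rintro ⟨f, rfl⟩
    refine ⟨f 1, fun k => ?_⟩
    split_ifs with h <;> simp [h, trivRho, LinearMap.lcomp_apply]
  · rintro ⟨m, hm⟩
    refine ⟨LinearMap.toSpanSingleton K M m, funext fun k => LinearMap.ext_ring ?_⟩
    rw [hm k]
    split_ifs with h <;> simp [h, trivRho, LinearMap.lcomp_apply]

end TrivialCoefficients

section SimpleModule

variable {K : Type} [Field K] {p : ℕ}

theorem sRho_neg_one_apply (v : Fin (p - 1) → K) (k : Fin (p - 1)) :
    sRho K p (-1) v k =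
      if _h : (k : ℕ) = 0 then 0 else v ⟨k - 1, (Nat.sub_le _ _).trans_lt k.2⟩ := by
  simp only [sRho, sMat, if_true, Matrix.toLin'_apply, Matrix.mulVec, dotProduct, Matrix.of_apply,
    ite_mul, one_mul, zero_mul]
  split_ifs
  · exact Finset.sum_eq_zero fun l _ => if_neg (by omega)
  · rw [Finset.sum_eq_single_of_mem (⟨k - 1, (Nat.sub_le _ _).trans_lt k.2⟩ : Fin (p - 1))
      (Finset.mem_univ _)]
    · exact if_pos (by simp only; omega)
    · intro l _ hl
      exact if_neg fun h' => hl (Fin.ext (by simp only; omega))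

theorem sRho_natCast_apply {j : ℕ} (hj : j ≤ p - 2) (hp : 2 ≤ p) (v : Fin (p - 1) → K)
    (k : Fin (p - 1)) :
    sRho K p j v k = if h : (k : ℕ) + j < p - 1 then sCoef K j (k + j) * v ⟨k + j, h⟩ else 0 := by
  have h1 : ¬((j : ℤ) = -1) := by omega
  have h2 : (0 : ℤ) ≤ j ∧ (j : ℤ) ≤ (p : ℤ) - 2 := by omega
  simp only [sRho, sMat, if_neg h1, if_pos h2, Matrix.toLin'_apply, Matrix.mulVec, dotProduct,
    Matrix.of_apply, ite_mul, zero_mul, Int.toNat_natCast]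
  split_ifs with h
  · rw [Finset.sum_eq_single_of_mem (⟨k + j, h⟩ : Fin (p - 1)) (Finset.mem_univ _)]
    · exact if_pos rfl
    · intro l _ hl
      exact if_neg fun h' => hl (Fin.ext h')
  · exact Finset.sum_eq_zero fun l _ => if_neg (by omega)

theorem sRho_zero_apply (hp : 2 ≤ p) (v : Fin (p - 1) → K) (k : Fin (p - 1)) :
    sRho K p 0 v k = -((k : K) + 1) * v k := by
  have := sRho_natCast_apply (K := K) (j := 0) (Nat.zero_le _) hp v k
  simpa [sCoef, k.2] using this

theorem sRho_neg_one_pow_apply (n : ℕ) (v : Fin (p - 1) → K) (k : Fin (p - 1)) (hk : (k : ℕ) < n) :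
    (sRho K p (-1) ^ n) v k = 0 := by
  induction n generalizing k with
  | zero => omega
  | succ n ih =>
    rw [pow_succ', Module.End.mul_apply, sRho_neg_one_apply]
    split_ifs with h
    · rfl
    · exact ih _ (by simp only; omega)

theorem sRho_natCast_pow_apply {j : ℕ} (hj : j ≤ p - 2) (hp : 2 ≤ p) (hj0 : j ≠ 0) (n : ℕ)
    (v : Fin (p - 1) → K) (k : Fin (p - 1)) (hk : p - 1 ≤ k + n) :
    (sRho K p j ^ n) v k = 0 := by
  induction n generalizing k with
  | zero => omega
  | succ n ih =>
    rw [pow_succ', Module.End.mul_apply, sRho_natCast_apply hj hp]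
    split_ifs with h
    · rw [ih _ (by simp only; omega), mul_zero]
    · rfl

theorem sRho_pow_eq_zero (hp : 2 ≤ p) {i : ℤ} (hi : -1 ≤ i) (hi' : i ≤ (p : ℤ) - 2) (hi0 : i ≠ 0) :
    sRho K p i ^ (p - 1) = 0 := by
  refine LinearMap.ext fun v => funext fun k => ?_
  obtain rfl | h := eq_or_ne i (-1)
  · exact sRho_neg_one_pow_apply _ v k k.2
  · lift i to ℕ using (by omega)
    exact sRho_natCast_pow_apply (by omega) hp (by omega) _ v k (by omega)

theorem factorial_mul_factorial_of_add_eq [Fact p.Prime] [CharP K p] {a b : ℕ}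
    (h : a + b + 1 = p) : (a.factorial : K) * b.factorial = (-1) ^ (a + 1) := by
  induction a generalizing b with
  | zero =>
    have hw := congrArg (ZMod.castHom (dvd_refl p) K) (ZMod.wilsons_lemma p)
    rw [map_natCast, map_neg, map_one] at hw
    obtain rfl : b = p - 1 := by omega
    simp [hw]
  | succ a ih =>
    have hab : ((a : K) + 1) = -((b : K) + 1) := by
      rw [eq_neg_iff_add_eq_zero, ← CharP.cast_eq_zero K p, ← h]
      push_cast
      ring
    have := ih (b := b + 1) (by omega)
    rw [Nat.factorial_succ] at this ⊢
    push_cast at this ⊢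
    rw [pow_succ, ← this, hab]
    ring

theorem factorial_cast_ne_zero [Fact p.Prime] [CharP K p] {a : ℕ} (h : a < p) :
    (a.factorial : K) ≠ 0 := by
  rw [Ne, CharP.cast_eq_zero_iff K p, (Fact.out : p.Prime).dvd_factorial]
  omega

theorem sCoef_mul_factorial [Fact p.Prime] [CharP K p] {i j k : ℕ} (h : k + i + (j + 1) + 1 = p) :
    sCoef K i (k + i) * j.factorial = ((i + (j + 1)).factorial : K) := by
  have h1 := factorial_mul_factorial_of_add_eq (K := K) (p := p) (a := k) (b := i + (j + 1))
    (by omega)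
  have h2 := factorial_mul_factorial_of_add_eq (K := K) (p := p) (a := k + i + 1) (b := j)
    (by omega)
  have h3 : (k.factorial : K) * ((k + i + 1).descFactorial (i + 1) : ℕ) = (k + i + 1).factorial := by
    have := Nat.factorial_mul_descFactorial (n := k + i + 1) (k := i + 1) (by omega)
    rw [show k + i + 1 - (i + 1) = k by omega] at this
    rw [← Nat.cast_mul, this]
  refine mul_left_cancel₀ (factorial_cast_ne_zero (K := K) (p := p) (a := k) (by omega)) ?_
  rw [h1, sCoef]
  calc (k.factorial : K) * ((-1) ^ (i + 1) * ((k + i + 1).descFactorial (i + 1) : ℕ) * j.factorial)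
      = (-1) ^ (i + 1) * ((k.factorial * ((k + i + 1).descFactorial (i + 1) : ℕ)) * j.factorial) := by
        ring
    _ = (-1) ^ (k + 1) * ((-1) ^ (i + 1)) ^ 2 := by rw [h3, h2]; ring
    _ = (-1) ^ (k + 1) := by rw [← pow_mul, mul_comm (i + 1), pow_mul]; simp

/-- Antisymmetry of the bracket and nilpotency of `e_i` (`i ≠ 0`) on `S` reduce the cocycle
conditions for a family vanishing at `0` to the bracket conditions with `i < j`. -/
theorem toSpanSingleton_mem_cocycles (hp : 2 ≤ p) {s : ℤ → Fin (p - 1) → K} (h0 : s 0 = 0)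
    (hs : ∀ k : ℤ, k < -1 ∨ (p : ℤ) - 2 < k → s k = 0)
    (hb : ∀ i j : ℤ, -1 ≤ i → i < j → j ≤ (p : ℤ) - 2 →
      ((j - i : ℤ) : K) • s (i + j) = sRho K p i (s j) - sRho K p j (s i)) :
    (fun k => LinearMap.toSpanSingleton K (Fin (p - 1) → K) (s k)) ∈
      cocycles K p (-1) (sRho K p) (trivRho K) := by
  rw [mem_cocycles_trivRho_iff (by omega)]
  simp only [LinearMap.toSpanSingleton_apply, one_smul]
  refine ⟨hs, fun i j hi hi' hj hj' => ?_, fun i hi hi' => ?_⟩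
  · rcases lt_trichotomy i j with h | rfl | h
    · exact hb i j hi h hj'
    · simp
    · rw [← neg_sub (sRho K p j (s i)), ← hb j i hj h hi', add_comm j i, ← neg_smul]
      push_cast
      rw [neg_sub]
  · obtain rfl | hi0 := eq_or_ne i 0
    · simp [h0]
    · simp [sRho_pow_eq_zero hp hi hi' hi0, hi0]

/-- The cocycle `e_{-1} ↦ u_0`, `e_j ↦ 0` for `j ≠ -1`. -/
def lowCocycle (K : Type) [Field K] (p : ℕ) (j : ℤ) (l : Fin (p - 1)) : K :=
  if j = -1 ∧ (l : ℕ) = 0 then 1 else 0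

/-- The cocycle `e_j ↦ (j+1)! u_{p-1-j}` for `j ≥ 1`, `e_{-1}, e_0 ↦ 0`. -/
def highCocycle (K : Type) [Field K] (p : ℕ) (j : ℤ) (l : Fin (p - 1)) : K :=
  if 1 ≤ j ∧ (l : ℤ) + j = p - 1 then ((j.toNat + 1).factorial : K) else 0

theorem highCocycle_natCast_succ (j : ℕ) (l : Fin (p - 1)) :
    highCocycle K p (j + 1 : ℕ) l =
      if (l : ℕ) + (j + 1) + 1 = p then ((j + 2).factorial : K) else 0 := by
  unfold highCocycle
  rw [Int.toNat_natCast]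
  exact if_congr (by omega) rfl rfl

theorem lowCocycle_mem (hp : 2 ≤ p) :
    (fun k => LinearMap.toSpanSingleton K (Fin (p - 1) → K) (lowCocycle K p k)) ∈
      cocycles K p (-1) (sRho K p) (trivRho K) := by
  have hne : ∀ k : ℤ, k ≠ -1 → lowCocycle K p k = 0 := fun k hk => by
    funext l
    simp [lowCocycle, hk]
  refine toSpanSingleton_mem_cocycles hp (hne 0 (by omega)) (fun k hk => hne k (by omega))
    fun i j hi hij hj => ?_
  rw [hne j (by omega), map_zero, zero_sub]
  obtain rfl | hi' := eq_or_ne i (-1)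
  · lift j to ℕ using (by omega)
    funext k
    rw [Pi.neg_apply, sRho_natCast_apply (by omega) hp]
    obtain rfl | hj0 := eq_or_ne j 0
    · have hk := k.2
      have hp1 : 1 < p := by omega
      by_cases hk0 : (k : ℕ) = 0 <;> simp [lowCocycle, hk0, hp1, sCoef]
    · rw [hne (-1 + j) (by omega)]
      have : (k : ℕ) + j ≠ 0 := by omega
      simp [lowCocycle, hj0]
  · rw [hne i hi', map_zero, neg_zero, hne (i + j) (by omega), smul_zero]

theorem highCocycle_mem [Fact p.Prime] [CharP K p] (hp : 2 ≤ p) :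
    (fun k => LinearMap.toSpanSingleton K (Fin (p - 1) → K) (highCocycle K p k)) ∈
      cocycles K p (-1) (sRho K p) (trivRho K) := by
  have hle : ∀ k : ℤ, k ≤ 0 → highCocycle K p k = 0 := fun k hk => by
    funext l
    exact if_neg (by omega)
  refine toSpanSingleton_mem_cocycles hp (hle 0 le_rfl) ?_ fun i j hi hij hj => ?_
  · rintro k (hk | hk)
    · exact hle k (by omega)
    · funext l
      unfold highCocycle
      split_ifs with h
      · rw [show k.toNat + 1 = p by omega, Pi.zero_apply, CharP.cast_eq_zero_iff K p]
        exact Nat.dvd_factorial (by omega) le_rfl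
      · rfl
  · obtain rfl | hi' := eq_or_ne i (-1)
    · lift j to ℕ using (by omega)
      rw [hle (-1) (by omega), map_zero, sub_zero]
      funext k
      rw [sRho_neg_one_apply, Pi.smul_apply, smul_eq_mul]
      rcases j with _ | _ | j
      · simp [hle]
      · simp only [zero_add, Nat.cast_one, neg_add_cancel, hle 0 le_rfl, Pi.zero_apply, mul_zero]
        split_ifs with h
        · rfl
        · exact (if_neg (by simp only; omega)).symm
      · rw [show (-1 : ℤ) + (j + 1 + 1 : ℕ) = (j + 1 : ℕ) by push_cast; ring,
          highCocycle_natCast_succ]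
        split_ifs with h h' h'
        · omega
        · rw [highCocycle_natCast_succ, if_pos (by simp only; omega),
            Nat.factorial_succ (j + 2)]
          push_cast
          ring
        · simp
        · rw [highCocycle_natCast_succ, if_neg (by simp only; omega), mul_zero]
    · lift i to ℕ using (by omega)
      lift j to ℕ using (by omega)
      obtain ⟨j, rfl⟩ : ∃ m, j = m + 1 := ⟨j - 1, by omega⟩
      funext k
      rw [Pi.sub_apply, sRho_natCast_apply (by omega) hp, sRho_natCast_apply (by omega) hp,
        Pi.smul_apply, smul_eq_mul, ← Nat.cast_add, ← add_assoc i j 1,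
        highCocycle_natCast_succ]
      by_cases hk : (k : ℕ) + (i + j + 1) + 1 = p
      · rw [if_pos hk, dif_pos (by omega), highCocycle_natCast_succ,
          if_pos (by simp only; omega)]
        have h1 := sCoef_mul_factorial (K := K) (p := p) (i := i) (j := j) (k := k) (by omega)
        rw [show i + (j + 1) = i + j + 1 by omega] at h1
        have e : ∀ n : ℕ, ((n + 2).factorial : K) = (n + 2) * ((n + 1) * n.factorial) := fun n => by
          rw [Nat.factorial_succ, Nat.factorial_succ]
          push_cast
          ring
        have e' : ((i + j + 2).factorial : K) = (i + j + 2) * (i + j + 1).factorial := by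
          rw [Nat.factorial_succ]
          push_cast
          ring
        rcases i with _ | i
        · rw [show ((0 : ℕ) : ℤ) = 0 from rfl, hle 0 le_rfl]
          have : (sCoef K 0 (k + 0)) = j + 1 := by
            refine mul_right_cancel₀ (factorial_cast_ne_zero (K := K) (p := p) (a := j) (by omega)) ?_
            rw [h1, Nat.zero_add, Nat.factorial_succ]
            push_cast
            ring
          rw [this, show 0 + j + 1 + 1 = j + 2 by ring]
          simp
        · have h2 := sCoef_mul_factorial (K := K) (p := p) (i := j + 1) (j := i) (k := k) (by omega)
          rw [show j + 1 + (i + 1) = i + 1 + j + 1 by omega] at h2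
          rw [dif_pos (by omega), highCocycle_natCast_succ, if_pos (by simp only; omega), e', e, e]
          push_cast
          linear_combination (-((j : K) + 2) * (j + 1)) * h1 + ((i : K) + 2) * (i + 1) * h2
      · rw [if_neg hk, mul_zero]
        have a1 : (if h : (k : ℕ) + i < p - 1 then
            sCoef K i (k + i) * highCocycle K p (j + 1 : ℕ) ⟨k + i, h⟩ else 0) = 0 := by
          split_ifs with h
          · rw [highCocycle_natCast_succ, if_neg (by simp only; omega), mul_zero]
          · rfl
        have a2 : (if h : (k : ℕ) + (j + 1) < p - 1 then
            sCoef K (j + 1) (k + (j + 1)) * highCocycle K p i ⟨k + (j + 1), h⟩ else 0) = 0 := by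
          split_ifs with h
          · rw [highCocycle, if_neg (by simp only; omega), mul_zero]
          · rfl
        rw [a1, a2, sub_zero]

theorem cast_ne_zero_of_pos_of_lt [CharP K p] {n : ℕ} (h : 0 < n) (h' : n < p) : (n : K) ≠ 0 := by
  rw [Ne, CharP.cast_eq_zero_iff K p]
  exact Nat.not_dvd_of_pos_of_lt h h'

theorem sRho_zero_sRho (hp : 2 ≤ p) {j : ℤ} (hj : -1 ≤ j) (hj' : j ≤ (p : ℤ) - 2)
    (v : Fin (p - 1) → K) :
    sRho K p 0 (sRho K p j v) - sRho K p j (sRho K p 0 v) = (j : K) • sRho K p j v := by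
  funext k
  rw [Pi.sub_apply, sRho_zero_apply hp, Pi.smul_apply, smul_eq_mul]
  obtain rfl | h := eq_or_ne j (-1)
  · rw [sRho_neg_one_apply, sRho_neg_one_apply]
    split_ifs with hk
    · simp
    · rw [sRho_zero_apply hp]
      simp only
      rw [Nat.cast_sub (by omega)]
      push_cast
      ring
  · lift j to ℕ using (by omega)
    rw [sRho_natCast_apply (by omega) hp, sRho_natCast_apply (by omega) hp]
    split_ifs with hk
    · rw [sRho_zero_apply hp]
      push_cast
      ring
    · simp

theorem sRho_neg_one_sRho [CharP K p] (hp : 2 ≤ p) {j : ℕ} (hj : j + 2 ≤ p - 2)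
    (v : Fin (p - 1) → K) :
    sRho K p (-1) (sRho K p (j + 2 : ℕ) v) - sRho K p (j + 2 : ℕ) (sRho K p (-1) v) =
      ((j : K) + 3) • sRho K p (j + 1 : ℕ) v := by
  funext k
  rw [Pi.sub_apply, sRho_neg_one_apply, Pi.smul_apply, smul_eq_mul,
    sRho_natCast_apply hj hp _ k, sRho_natCast_apply (by omega) hp v k]
  set D : K := (((k : ℕ) + (j + 1) + 1).descFactorial (j + 2) : K) with hD
  have c1 : sCoef K (j + 1) (k + (j + 1)) = (-1) ^ (j + 2) * D := rfl
  have c2 : sCoef K (j + 2) (k + (j + 1)) = -(-1) ^ (j + 2) * (k * D) := by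
    rw [sCoef, Nat.descFactorial_succ, show (k : ℕ) + (j + 1) + 1 - (j + 2) = k by omega,
      Nat.cast_mul, hD]
    ring
  have c3 : sCoef K (j + 2) (k + (j + 2)) = -(-1) ^ (j + 2) * ((k + j + 3) * D) := by
    rw [sCoef, Nat.succ_descFactorial_succ, Nat.cast_mul, hD,
      show (k : ℕ) + (j + 2) = k + (j + 1) + 1 by ring]
    push_cast
    ring
  by_cases h : (k : ℕ) + (j + 1) < p - 1
  · have hleft : (if _ : (k : ℕ) = 0 then 0 else
        sRho K p (j + 2 : ℕ) v ⟨k - 1, (Nat.sub_le _ _).trans_lt k.2⟩) =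
        -(-1) ^ (j + 2) * (k * D) * v ⟨k + (j + 1), h⟩ := by
      split_ifs with hk
      · simp [hk]
      · have e : (k : ℕ) - 1 + (j + 2) = k + (j + 1) := by omega
        rw [sRho_natCast_apply (by omega) hp, ← c2]
        simp only [e, h, dif_pos]
    have hright : (if h : (k : ℕ) + (j + 2) < p - 1 then
        sCoef K (j + 2) (k + (j + 2)) * sRho K p (-1) v ⟨k + (j + 2), h⟩ else 0) =
        -(-1) ^ (j + 2) * ((k + j + 3) * D) * v ⟨k + (j + 1), h⟩ := by
      split_ifs with h2
      · rw [c3, sRho_neg_one_apply, dif_neg (by simp only; omega)]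
        rfl
      · have := congrArg (Nat.cast (R := K)) (show (k : ℕ) + j + 3 = p by omega)
        rw [CharP.cast_eq_zero K p] at this
        push_cast at this
        rw [this]
        ring
    rw [hleft, hright, dif_pos h, c1]
    ring
  · rw [dif_neg h, dif_neg (show ¬(k : ℕ) + (j + 2) < p - 1 by omega)]
    split_ifs with hk
    · simp
    · rw [sRho_natCast_apply (by omega) hp, dif_neg (by simp only; omega)]
      simp

/-- A cocycle vanishing on `e_0` is determined by the `u_0`-coordinate of its value at `e_{-1}`
and the `u_{p-2}`-coordinate of its value at `e_1`. -/
theorem eq_zero_of_bracket [CharP K p] (hp : 3 < p) {s : ℤ → Fin (p - 1) → K} (h0 : s 0 = 0)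
    (hb0 : ∀ j : ℤ, -1 ≤ j → j ≤ (p : ℤ) - 2 → (j : K) • s j = sRho K p 0 (s j))
    (hb : ∀ j : ℕ, j + 2 ≤ p - 2 → ((j : K) + 3) • s (j + 1 : ℕ) =
      sRho K p (-1) (s (j + 2 : ℕ)) - sRho K p (j + 2 : ℕ) (s (-1)))
    (hlow : s (-1) ⟨0, by omega⟩ = 0) (hhigh : s 1 ⟨p - 2, by omega⟩ = 0)
    {j : ℤ} (hj : -1 ≤ j) (hj' : j ≤ (p : ℤ) - 2) : s j = 0 := by
  have hw : ∀ j : ℤ, -1 ≤ j → j ≤ (p : ℤ) - 2 → ∀ l : Fin (p - 1),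
      ((j : K) + l + 1) * s j l = 0 := fun j hj hj' l => by
    have := congrFun (hb0 j hj hj') l
    rw [sRho_zero_apply (by omega), Pi.smul_apply,
      smul_eq_mul] at this
    linear_combination this
  have hneg : s (-1) = 0 := funext fun l => by
    by_cases hl : (l : ℕ) = 0
    · rw [Pi.zero_apply, ← hlow]
      exact congrArg _ (Fin.ext hl)
    · have := hw (-1) (by omega) (by omega) l
      push_cast at this
      rw [neg_add_cancel_comm] at this
      exact (mul_eq_zero.1 this).resolve_left
        (cast_ne_zero_of_pos_of_lt (p := p) (by omega) (by omega))
  have hnat : ∀ j : ℕ, j ≤ p - 2 → s (j + 1 : ℕ) = 0 ∨ p - 2 < j + 1 := by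
    intro j
    induction j with
    | zero =>
      refine fun _ => Or.inl (funext fun l => ?_)
      by_cases hl : (l : ℕ) = p - 2
      · rw [Pi.zero_apply, ← hhigh]
        exact congrArg _ (Fin.ext hl)
      · have := hw 1 (by omega) (by omega) l
        refine (mul_eq_zero.1 this).resolve_left ?_
        rw [show ((1 : ℤ) : K) + l + 1 = ((l + 2 : ℕ) : K) by push_cast; ring]
        exact cast_ne_zero_of_pos_of_lt (p := p) (by omega) (by omega)
    | succ j ih =>
      intro hj
      by_cases hj1 : p - 2 < j + 1 + 1
      · exact Or.inr hj1
      refine Or.inl (funext fun l => ?_)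
      have hs := (ih (by omega)).resolve_right (by omega)
      by_cases hl : (l : ℕ) = p - 2
      · have := hw (j + 1 + 1 : ℕ) (by omega) (by omega) l
        refine (mul_eq_zero.1 this).resolve_left ?_
        have hpl : ((l : K) + 2) = 0 := by
          have := congrArg (Nat.cast (R := K)) (show (l : ℕ) + 2 = p by omega)
          rw [CharP.cast_eq_zero K p] at this
          exact_mod_cast this
        rw [show (((j + 1 + 1 : ℕ) : ℤ) : K) + l + 1 = ((j + 1 : ℕ) : K) by
          push_cast; linear_combination hpl]
        exact cast_ne_zero_of_pos_of_lt (p := p) (by omega) (by omega)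
      · have := congrFun (hb j (by omega)) ⟨l + 1, by omega⟩
        rw [hs, hneg, map_zero, smul_zero, sub_zero, sRho_neg_one_apply,
          dif_neg (by simp only; omega)] at this
        exact this.symm
  rcases lt_trichotomy j 0 with h | rfl | h
  · rwa [show j = -1 by omega]
  · exact h0
  · obtain ⟨n, rfl⟩ : ∃ n : ℕ, j = (n + 1 : ℕ) := ⟨(j - 1).toNat, by omega⟩
    exact (hnat n (by omega)).resolve_right (by omega)

/-- The two coordinates of a cocycle that detect its class in `Ext(K, S)`. -/
def extCoords (hp : 3 < p) :
    cocycles K p (-1) (sRho K p) (trivRho K) →ₗ[K] K × K :=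
  LinearMap.prod
    (LinearMap.proj (⟨0, by omega⟩ : Fin (p - 1)) ∘ₗ LinearMap.applyₗ (1 : K) ∘ₗ
      LinearMap.proj (-1 : ℤ) ∘ₗ Submodule.subtype _)
    (LinearMap.proj (⟨p - 2, by omega⟩ : Fin (p - 1)) ∘ₗ LinearMap.applyₗ (1 : K) ∘ₗ
      LinearMap.proj (1 : ℤ) ∘ₗ Submodule.subtype _)

theorem extCoords_apply (hp : 3 < p) (c : cocycles K p (-1) (sRho K p) (trivRho K)) :
    extCoords hp c = (c.1 (-1) 1 ⟨0, by omega⟩, c.1 1 1 ⟨p - 2, by omega⟩) := rfl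

theorem extCoords_surjective [CharP K p] (hp : 3 < p) :
    Function.Surjective (extCoords (K := K) hp) := by
  have : Fact p.Prime := ⟨(CharP.char_is_prime_or_zero K p).resolve_right (by omega)⟩
  rintro ⟨a, b⟩
  have h2 : (2 : K) ≠ 0 := by
    exact_mod_cast cast_ne_zero_of_pos_of_lt (K := K) (p := p) (n := 2) (by omega) (by omega)
  refine ⟨a • ⟨_, lowCocycle_mem (K := K) (p := p) (by omega)⟩ +
    (b / 2) • ⟨_, highCocycle_mem (K := K) (p := p) (by omega)⟩, ?_⟩
  have hhigh : ((p - 2 : ℕ) : ℤ) + 1 = p - 1 := by omega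
  simp [extCoords_apply, lowCocycle, highCocycle, hhigh, h2]

theorem ker_extCoords [CharP K p] (hp : 3 < p) :
    LinearMap.ker (extCoords (K := K) hp) =
      Submodule.comap (cocycles K p (-1) (sRho K p) (trivRho K)).subtype
        (coboundaries K p (-1) (sRho K p) (trivRho K)) := by
  ext ⟨c, hc⟩
  rw [LinearMap.mem_ker, extCoords_apply, Submodule.mem_comap, Submodule.subtype_apply,
    mem_coboundaries_trivRho_iff, Prod.mk_eq_zero]
  rw [mem_cocycles_trivRho_iff (by omega)] at hc
  obtain ⟨hs, hb, -⟩ := hc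
  constructor
  · rintro ⟨hlow, hhigh⟩
    have hne : ∀ l : Fin (p - 1), ((l : K) + 1) ≠ 0 := fun l => by
      exact_mod_cast cast_ne_zero_of_pos_of_lt (K := K) (p := p) (n := l + 1) (by omega) (by omega)
    set m : Fin (p - 1) → K := fun l => -(c 0 1 l / (l + 1)) with hm
    have hm0 : sRho K p 0 m = c 0 1 := funext fun l => by
      rw [sRho_zero_apply (by omega), hm, neg_mul_neg, mul_div_cancel₀ _ (hne l)]
    refine ⟨m, fun k => ?_⟩
    split_ifs with hk
    · refine sub_eq_zero.1 (eq_zero_of_bracket hp (s := fun k => c k 1 - sRho K p k m)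
        (sub_eq_zero.2 hm0.symm) (fun j hj hj' => ?_) (fun j hj => ?_) ?_ ?_ hk.1 hk.2)
      · have h := hb 0 j (by omega) (by omega) hj hj'
        rw [sub_zero, zero_add, ← hm0] at h
        rw [smul_sub, map_sub, h, ← sRho_zero_sRho (by omega) hj hj']
        abel
      · have h := hb (-1) (j + 2 : ℕ) (by omega) (by omega) (by omega) (by omega)
        rw [show (-1 : ℤ) + (j + 2 : ℕ) = (j + 1 : ℕ) by push_cast; ring,
          show (((j + 2 : ℕ) - -1 : ℤ) : K) = j + 3 by push_cast; ring] at h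
        rw [smul_sub, map_sub, map_sub, h, ← sRho_neg_one_sRho (by omega) hj]
        abel
      · rw [Pi.sub_apply, hlow, sRho_neg_one_apply, dif_pos rfl, sub_zero]
      · have := sRho_natCast_apply (K := K) (p := p) (j := 1) (by omega) (by omega) m
          ⟨p - 2, by omega⟩
        rw [dif_neg (by simp only; omega), Nat.cast_one] at this
        rw [Pi.sub_apply, hhigh, this, sub_zero]
    · exact hs k (by omega)
  · rintro ⟨m, hm⟩
    constructor
    · simp only [hm]
      rw [if_pos (by omega), sRho_neg_one_apply, dif_pos rfl]
    · simp only [hm]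
      rw [if_pos (by omega)]
      have := sRho_natCast_apply (K := K) (p := p) (j := 1) (by omega) (by omega) m
        ⟨p - 2, by omega⟩
      rw [dif_neg (by simp only; omega)] at this
      exact_mod_cast this

end SimpleModule

/-- For `χ = 0`, `Ext(K, S) ≅ K²` in the category of restricted `W`-modules:
the space of Baer-equivalence classes of short exact sequences `0 → S → M → K → 0`
of restricted `W`-modules is two-dimensional over `K`. -/
theorem ext_trivial_S
    (K : Type) [Field K] [IsAlgClosed K] (p : ℕ) [CharP K p] (hp : 3 < p)
    :
    Module.finrank K (extSpace K p (-1) (sRho K p) (trivRho K)) = 2 := by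
  exact (Submodule.quotEquivOfEq _ _ (ker_extCoords hp).symm ≪≫ₗ
    (extCoords hp).quotKerEquivOfSurjective (extCoords_surjective hp)).finrank_eq.trans
      (by simp)
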